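/- Let a, b, c, d, e, f, g ∈ ℂ with e, f, g, 1−g+e, 1−g+f, 2−g all not equal to a nonpositive integer. Then the function u(x,y) = y^{1−g} · F1(1−g+a, b, c, 1−g+d; 1−g+e, 1−g+f; 2−g; x, y), where y^{1−g} = exp((1−g)·log y) for y > 0, satisfies at every point of D = {(x,y) ∈ ℝ² : 0 < x < 1, 0 < y} the fourth-order partial differential equation y³·u_yyyy + x²y·u_xxyy + 2xy²·u_xyyy + (e+f+g+3)y²·u_yyy + (e+f+2g+3)xy·u_xyy + g x²·u_xxy + ([(e+1)(f+1)+(e+f+1)g] − y)·y·u_yy + [(e+f+1)g − y]·x·u_xy − dx·u_x + [efg − (a+d+1)y]·u_y − ad·u = 0. -/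

import Mathlib

noncomputable def poch (a : ℂ) (n : ℕ) : ℂ := ∏ i ∈ Finset.range n, (a + i)

noncomputable def pdx (u : ℝ → ℝ → ℂ) : ℝ → ℝ → ℂ := fun x y => deriv (fun t => u t y) x
noncomputable def pdy (u : ℝ → ℝ → ℂ) : ℝ → ℝ → ℂ := fun x y => deriv (fun t => u x t) y

/-- Kampé de Fériet function of the fourth order. -/
noncomputable def F1 (a b c d e f g x y : ℂ) : ℂ :=
  ∑' p : ℕ × ℕ,
    poch a (p.1 + p.2) * poch b p.1 * poch c p.1 * poch d p.2 /
      (poch e (p.1 + p.2) * poch f (p.1 + p.2) * poch g p.2 *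
        (Nat.factorial p.1 : ℂ) * (Nat.factorial p.2 : ℂ)) * x ^ p.1 * y ^ p.2

open Filter Topology

section PochhammerBounds

theorem poch_succ (a : ℂ) (n : ℕ) : poch a (n + 1) = poch a n * (a + n) :=
  Finset.prod_range_succ _ _

theorem poch_ne_zero {a : ℂ} (ha : ∀ n : ℕ, a ≠ -(n : ℂ)) (n : ℕ) : poch a n ≠ 0 :=
  Finset.prod_ne_zero_iff.2 fun i _ h => ha i (eq_neg_of_add_eq_zero_left h)

theorem exists_forall_le_of_eventually_succ_le {v : ℕ → ℝ}
    (h : ∀ᶠ n in atTop, v (n + 1) ≤ v n) : ∃ C, 0 ≤ C ∧ ∀ n, v n ≤ C := by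
  obtain ⟨N, hN⟩ := eventually_atTop.1 h
  have hsum : ∀ k, v k ≤ ∑ i ∈ Finset.range (N + 1), |v i| := by
    have hsmall : ∀ k ≤ N, v k ≤ ∑ i ∈ Finset.range (N + 1), |v i| := fun k hk =>
      (le_abs_self _).trans (Finset.single_le_sum (f := fun i => |v i|)
        (fun i _ => abs_nonneg _) (Finset.mem_range.2 (by omega)))
    intro k
    rcases le_total k N with hk | hk
    · exact hsmall k hk
    · induction k, hk using Nat.le_induction with
      | base => exact hsmall N le_rfl
      | succ k hk ih => exact (hN k hk).trans ih
  exact ⟨_, Finset.sum_nonneg fun i _ => abs_nonneg _, hsum⟩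

theorem exists_norm_poch_le (a : ℂ) {q : ℝ} (hq : 1 < q) :
    ∃ C, 0 ≤ C ∧ ∀ n : ℕ, ‖poch a n‖ ≤ C * (q ^ n * n.factorial) := by
  have hq0 : 0 < q := by linarith
  obtain ⟨C, hC0, hC⟩ := exists_forall_le_of_eventually_succ_le
    (v := fun n => ‖poch a n‖ / (q ^ n * n.factorial)) (by
      filter_upwards [tendsto_natCast_atTop_atTop.eventually_ge_atTop (‖a‖ / (q - 1))] with n hn
      rw [div_le_iff₀ (by linarith)] at hn
      have h1 : ‖a + n‖ ≤ q * (n + 1) := by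
        have := norm_add_le a (n : ℂ)
        rw [Complex.norm_natCast] at this
        nlinarith
      rw [poch_succ, norm_mul, div_le_div_iff₀ (by positivity) (by positivity), pow_succ,
        Nat.factorial_succ]
      push_cast
      calc ‖poch a n‖ * ‖a + n‖ * (q ^ n * n.factorial)
          ≤ ‖poch a n‖ * (q * (n + 1)) * (q ^ n * n.factorial) := by gcongr
        _ = _ := by ring)
  refine ⟨C, hC0, fun n => ?_⟩
  have := hC n
  rwa [div_le_iff₀ (by positivity)] at this

theorem exists_norm_inv_poch_le {a : ℂ} (ha : ∀ n : ℕ, a ≠ -(n : ℂ)) {q : ℝ} (hq : 1 < q) :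
    ∃ C, 0 ≤ C ∧ ∀ n : ℕ, ‖(poch a n)⁻¹‖ ≤ C * (q ^ n / n.factorial) := by
  have hq0 : 0 < q := by linarith
  obtain ⟨C, hC0, hC⟩ := exists_forall_le_of_eventually_succ_le
    (v := fun n => n.factorial / (q ^ n * ‖poch a n‖)) (by
      filter_upwards [tendsto_natCast_atTop_atTop.eventually_ge_atTop
        ((1 + q * ‖a‖) / (q - 1))] with n hn
      rw [div_le_iff₀ (by linarith)] at hn
      have h1 : (n + 1 : ℝ) ≤ q * ‖a + n‖ := by
        have := norm_sub_le (a + n) a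
        rw [add_sub_cancel_left, Complex.norm_natCast] at this
        nlinarith
      have h2 := norm_pos_iff.2 (poch_ne_zero ha n)
      have h3 := norm_pos_iff.2 (poch_ne_zero ha (n + 1))
      rw [div_le_div_iff₀ (by positivity) (by positivity), poch_succ, norm_mul, pow_succ,
        Nat.factorial_succ]
      push_cast
      calc ((n : ℝ) + 1) * n.factorial * (q ^ n * ‖poch a n‖)
          ≤ (q * ‖a + n‖) * n.factorial * (q ^ n * ‖poch a n‖) := by gcongr
        _ = _ := by ring)
  refine ⟨C, hC0, fun n => ?_⟩
  have h2 := norm_pos_iff.2 (poch_ne_zero ha n)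
  have := hC n
  rw [div_le_iff₀ (by positivity)] at this
  rw [norm_inv, ← mul_div_assoc, le_div_iff₀ (by positivity), inv_mul_le_iff₀ h2]
  linarith

end PochhammerBounds

section DoubleSeries

/-- The double power series with coefficients `A`. -/
noncomputable def doubleSeries (A : ℕ × ℕ → ℂ) (x y : ℂ) : ℂ :=
  ∑' p : ℕ × ℕ, A p * x ^ p.1 * y ^ p.2

/-- The double power series with coefficients `A` converges absolutely for `|x| < 1` and all `y`. -/
def StripSummable (A : ℕ × ℕ → ℂ) : Prop :=
  ∀ r R : ℝ, 0 < r → r < 1 → 0 < R → Summable fun p : ℕ × ℕ => ‖A p‖ * r ^ p.1 * R ^ p.2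

namespace StripSummable

variable {A : ℕ × ℕ → ℂ}

theorem const_mul (hA : StripSummable A) (c : ℂ) : StripSummable fun p => c * A p := by
  intro r R hr hr1 hR
  simpa [mul_assoc] using (hA r R hr hr1 hR).mul_left ‖c‖

theorem add {B : ℕ × ℕ → ℂ} (hA : StripSummable A) (hB : StripSummable B) :
    StripSummable fun p => A p + B p := by
  intro r R hr hr1 hR
  refine ((hA r R hr hr1 hR).add (hB r R hr hr1 hR)).of_nonneg_of_le
    (fun p => by positivity) fun p => ?_
  rw [← add_mul, ← add_mul]
  gcongr
  exact norm_add_le _ _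

theorem fst_mul (hA : StripSummable A) : StripSummable fun p => (p.1 : ℂ) * A p := by
  intro r R hr hr1 hR
  have hρ : 0 < (1 + r) / 2 := by linarith
  have hq0 : 0 ≤ r / ((1 + r) / 2) := by positivity
  have hq1 : r / ((1 + r) / 2) < 1 := by rw [div_lt_one hρ]; linarith
  obtain ⟨C, hC⟩ := (tendsto_self_mul_const_pow_of_lt_one hq0 hq1).bddAbove_range
  refine ((hA ((1 + r) / 2) R hρ (by linarith) hR).mul_left C).of_nonneg_of_le
    (fun p => by positivity) fun p => ?_
  have h1 : (p.1 : ℝ) * (r / ((1 + r) / 2)) ^ p.1 ≤ C := hC ⟨p.1, rfl⟩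
  have h2 : (p.1 : ℝ) * r ^ p.1 ≤ C * ((1 + r) / 2) ^ p.1 := by
    rw [div_pow, ← mul_div_assoc, div_le_iff₀ (by positivity)] at h1
    exact h1
  rw [norm_mul, Complex.norm_natCast]
  calc (p.1 : ℝ) * ‖A p‖ * r ^ p.1 * R ^ p.2
      = (p.1 * r ^ p.1) * (‖A p‖ * R ^ p.2) := by ring
    _ ≤ (C * ((1 + r) / 2) ^ p.1) * (‖A p‖ * R ^ p.2) := by gcongr
    _ = _ := by ring

theorem snd_mul (hA : StripSummable A) : StripSummable fun p => (p.2 : ℂ) * A p := by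
  intro r R hr hr1 hR
  refine (hA r (2 * R) hr hr1 (by positivity)).of_nonneg_of_le
    (fun p => by positivity) fun p => ?_
  have h1 : (p.2 : ℝ) ≤ 2 ^ p.2 := by exact_mod_cast Nat.lt_two_pow_self.le
  rw [norm_mul, Complex.norm_natCast, mul_pow]
  calc (p.2 : ℝ) * ‖A p‖ * r ^ p.1 * R ^ p.2
      ≤ 2 ^ p.2 * ‖A p‖ * r ^ p.1 * R ^ p.2 := by gcongr
    _ = _ := by ring

theorem fst_add_mul (hA : StripSummable A) (c : ℂ) :
    StripSummable fun p => ((p.1 : ℂ) + c) * A p := by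
  simpa only [add_mul] using hA.fst_mul.add (hA.const_mul c)

theorem snd_add_mul (hA : StripSummable A) (c : ℂ) :
    StripSummable fun p => ((p.2 : ℂ) + c) * A p := by
  simpa only [add_mul] using hA.snd_mul.add (hA.const_mul c)

theorem summable_norm (hA : StripSummable A) {x y : ℂ} (hx : ‖x‖ < 1) :
    Summable fun p : ℕ × ℕ => ‖A p‖ * ‖x‖ ^ p.1 * ‖y‖ ^ p.2 := by
  refine (hA ((1 + ‖x‖) / 2) (‖y‖ + 1) (by positivity) (by linarith)
    (by positivity)).of_nonneg_of_le (fun p => by positivity) fun p => ?_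
  gcongr <;> linarith

theorem hasSum (hA : StripSummable A) {x y : ℂ} (hx : ‖x‖ < 1) :
    HasSum (fun p : ℕ × ℕ => A p * x ^ p.1 * y ^ p.2) (doubleSeries A x y) := by
  refine Summable.hasSum (Summable.of_norm ?_)
  simpa using hA.summable_norm (y := y) hx

theorem hasDerivAt_fst (hA : StripSummable A) {x : ℂ} (y : ℂ) (hx : ‖x‖ < 1) (hx0 : x ≠ 0) :
    HasDerivAt (fun t => doubleSeries A t y)
      (x⁻¹ * doubleSeries (fun p => (p.1 : ℂ) * A p) x y) x := by
  obtain ⟨r, hxr, hr1⟩ := exists_between hx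
  have hr : 0 < r := (norm_nonneg x).trans_lt hxr
  have hsum := (hA.fst_mul r (‖y‖ + 1) hr hr1 (by positivity)).mul_left r⁻¹
  have key := hasDerivAt_tsum_of_isPreconnected
    (g := fun (p : ℕ × ℕ) (t : ℂ) => A p * t ^ p.1 * y ^ p.2)
    (g' := fun (p : ℕ × ℕ) (t : ℂ) => A p * (p.1 * t ^ (p.1 - 1)) * y ^ p.2)
    hsum Metric.isOpen_ball (convex_ball (0 : ℂ) r).isPreconnected
    (fun p t _ => ((hasDerivAt_pow p.1 t).const_mul (A p)).mul_const _)
    (fun p t ht => by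
      rw [mem_ball_zero_iff] at ht
      have hy : ‖y‖ ^ p.2 ≤ (‖y‖ + 1) ^ p.2 := by gcongr; linarith
      have ht' : ‖t‖ ^ (p.1 - 1) ≤ r ^ (p.1 - 1) := by gcongr
      have hpow : (p.1 : ℝ) * r ^ (p.1 - 1) = r⁻¹ * (p.1 * r ^ p.1) := by
        rcases p.1 with _ | k
        · simp
        · simp only [Nat.add_sub_cancel, pow_succ]
          field_simp
      simp only [norm_mul, norm_pow, Complex.norm_natCast]
      calc ‖A p‖ * (p.1 * ‖t‖ ^ (p.1 - 1)) * ‖y‖ ^ p.2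
          ≤ ‖A p‖ * (p.1 * r ^ (p.1 - 1)) * (‖y‖ + 1) ^ p.2 := by gcongr
        _ = _ := by rw [hpow]; ring)
    (mem_ball_zero_iff.2 hxr) (hA.hasSum hx).summable (mem_ball_zero_iff.2 hxr)
  refine key.congr_deriv ?_
  rw [doubleSeries, ← tsum_mul_left]
  refine tsum_congr fun p => ?_
  rcases p with ⟨_ | k, n⟩
  · simp
  · simp only [Nat.add_sub_cancel, pow_succ]
    field_simp

theorem hasDerivAt_snd (hA : StripSummable A) {x y : ℂ} (hx : ‖x‖ < 1) (hy0 : y ≠ 0) :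
    HasDerivAt (fun t => doubleSeries A x t)
      (y⁻¹ * doubleSeries (fun p => (p.2 : ℂ) * A p) x y) y := by
  set R := ‖y‖ + 1 with hRdef
  have hyR : ‖y‖ < R := by linarith
  have hR : 0 < R := by positivity
  have hr : 0 < (1 + ‖x‖) / 2 := by positivity
  have hxr : ‖x‖ ≤ (1 + ‖x‖) / 2 := by linarith
  have hsum := (hA.snd_mul _ R hr (by linarith) hR).mul_left R⁻¹
  have key := hasDerivAt_tsum_of_isPreconnected
    (g := fun (p : ℕ × ℕ) (t : ℂ) => A p * x ^ p.1 * t ^ p.2)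
    (g' := fun (p : ℕ × ℕ) (t : ℂ) => A p * x ^ p.1 * (p.2 * t ^ (p.2 - 1)))
    hsum Metric.isOpen_ball (convex_ball (0 : ℂ) R).isPreconnected
    (fun p t _ => (hasDerivAt_pow p.2 t).const_mul _)
    (fun p t ht => by
      rw [mem_ball_zero_iff] at ht
      have ht' : ‖t‖ ^ (p.2 - 1) ≤ R ^ (p.2 - 1) := by gcongr
      have hpow : (p.2 : ℝ) * R ^ (p.2 - 1) = R⁻¹ * (p.2 * R ^ p.2) := by
        rcases p.2 with _ | k
        · simp
        · simp only [Nat.add_sub_cancel, pow_succ]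
          field_simp
      simp only [norm_mul, norm_pow, Complex.norm_natCast]
      calc ‖A p‖ * ‖x‖ ^ p.1 * (p.2 * ‖t‖ ^ (p.2 - 1))
          ≤ ‖A p‖ * ((1 + ‖x‖) / 2) ^ p.1 * (p.2 * R ^ (p.2 - 1)) := by gcongr
        _ = _ := by rw [hpow]; ring)
    (mem_ball_zero_iff.2 hyR) (hA.hasSum hx).summable (mem_ball_zero_iff.2 hyR)
  refine key.congr_deriv ?_
  rw [doubleSeries, ← tsum_mul_left]
  refine tsum_congr fun p => ?_
  rcases p with ⟨m, _ | k⟩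
  · simp
  · simp only [Nat.add_sub_cancel, pow_succ]
    field_simp

end StripSummable

end DoubleSeries

section TwistedSeries

/-- On the strip `0 < x < 1`, `0 < y`, the function `v` equals
`x ^ (-i) * y ^ (σ - j) * ∑ A (m, n) * x ^ m * y ^ n`, with an absolutely convergent series. -/
structure IsTwistedSeries (σ : ℂ) (v : ℝ → ℝ → ℂ) (i j : ℕ) (A : ℕ × ℕ → ℂ) : Prop where
  summable : StripSummable A
  eq : ∀ x y : ℝ, 0 < x → x < 1 → 0 < y → v x y =
    ((x : ℂ) ^ i)⁻¹ * ((y : ℂ) ^ j)⁻¹ * Complex.exp (σ * (Real.log y : ℂ)) * doubleSeries A x y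

namespace IsTwistedSeries

variable {σ : ℂ} {v : ℝ → ℝ → ℂ} {i j : ℕ} {A : ℕ × ℕ → ℂ}

theorem pdx (h : IsTwistedSeries σ v i j A) :
    IsTwistedSeries σ (pdx v) (i + 1) j fun p => ((p.1 : ℂ) + -(i : ℂ)) * A p := by
  refine ⟨h.summable.fst_add_mul _, fun x y hx hx1 hy => ?_⟩
  have hx0 : (x : ℂ) ≠ 0 := by exact_mod_cast hx.ne'
  have hxn : ‖(x : ℂ)‖ < 1 := by rwa [Complex.norm_real, Real.norm_of_nonneg hx.le]
  have hev : (fun t : ℝ => v t y) =ᶠ[𝓝 x] fun t : ℝ => ((t : ℂ) ^ i)⁻¹ *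
      doubleSeries A t y * (((y : ℂ) ^ j)⁻¹ * Complex.exp (σ * (Real.log y : ℂ))) := by
    filter_upwards [Ioo_mem_nhds hx hx1] with t ht
    rw [h.eq t y ht.1 ht.2 hy]
    ring
  have hpow : HasDerivAt (fun t : ℂ => (t ^ i)⁻¹) (-(i : ℂ) * ((x : ℂ) ^ (i + 1))⁻¹) x := by
    refine ((hasDerivAt_pow i (x : ℂ)).inv (pow_ne_zero i hx0)).congr_deriv ?_
    rcases i with _ | k
    · simp
    · simp only [Nat.add_sub_cancel]
      field_simp
      ring
  have hd := ((hpow.mul (h.summable.hasDerivAt_fst y hxn hx0)).mul_const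
    (((y : ℂ) ^ j)⁻¹ * Complex.exp (σ * (Real.log y : ℂ)))).comp_ofReal
  have hS : doubleSeries (fun p => ((p.1 : ℂ) + -(i : ℂ)) * A p) x y =
      doubleSeries (fun p => (p.1 : ℂ) * A p) x y + -(i : ℂ) * doubleSeries A x y := by
    refine ((h.summable.fst_add_mul (-(i : ℂ))).hasSum hxn).unique ?_
    convert (h.summable.fst_mul.hasSum (y := y) hxn).add
      ((h.summable.hasSum (y := y) hxn).mul_left (-(i : ℂ))) using 2
    ring
  rw [_root_.pdx, hev.deriv_eq]
  refine hd.deriv.trans ?_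
  rw [hS, pow_succ]
  field_simp
  ring

theorem pdy (h : IsTwistedSeries σ v i j A) :
    IsTwistedSeries σ (pdy v) i (j + 1) fun p => ((p.2 : ℂ) + (σ - j)) * A p := by
  refine ⟨h.summable.snd_add_mul _, fun x y hx hx1 hy => ?_⟩
  have hx0 : (x : ℂ) ≠ 0 := by exact_mod_cast hx.ne'
  have hy0 : (y : ℂ) ≠ 0 := by exact_mod_cast hy.ne'
  have hxn : ‖(x : ℂ)‖ < 1 := by rwa [Complex.norm_real, Real.norm_of_nonneg hx.le]
  have hev : (fun t : ℝ => v x t) =ᶠ[𝓝 y] fun t : ℝ => ((x : ℂ) ^ i)⁻¹ *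
      (((t : ℂ) ^ j)⁻¹ * doubleSeries A x t * Complex.exp (σ * (Real.log t : ℂ))) := by
    filter_upwards [Ioi_mem_nhds hy] with t ht
    rw [h.eq x t hx hx1 ht]
    ring
  have hpow : HasDerivAt (fun t : ℂ => (t ^ j)⁻¹) (-(j : ℂ) * ((y : ℂ) ^ (j + 1))⁻¹) y := by
    refine ((hasDerivAt_pow j (y : ℂ)).inv (pow_ne_zero j hy0)).congr_deriv ?_
    rcases j with _ | k
    · simp
    · simp only [Nat.add_sub_cancel]
      field_simp
      ring
  have hexp := ((Real.hasDerivAt_log hy.ne').ofReal_comp.const_mul σ).cexp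
  have hd := (((hpow.mul (h.summable.hasDerivAt_snd hxn hy0)).comp_ofReal).mul hexp).const_mul
    ((x : ℂ) ^ i)⁻¹
  have hS : doubleSeries (fun p => ((p.2 : ℂ) + (σ - j)) * A p) x y =
      doubleSeries (fun p => (p.2 : ℂ) * A p) x y + (σ - j) * doubleSeries A x y := by
    refine ((h.summable.snd_add_mul (σ - j)).hasSum hxn).unique ?_
    convert (h.summable.snd_mul.hasSum (y := y) hxn).add
      ((h.summable.hasSum (y := y) hxn).mul_left (σ - j)) using 2
    ring
  rw [_root_.pdy, hev.deriv_eq]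
  refine hd.deriv.trans ?_
  rw [hS, pow_succ]
  push_cast
  simp only [Pi.mul_apply]
  field_simp
  ring

end IsTwistedSeries

end TwistedSeries

section KampeDeFeriet

/-- The coefficients of the series `F1`. -/
noncomputable def F1Coeff (a b c d e f g : ℂ) (p : ℕ × ℕ) : ℂ :=
  poch a (p.1 + p.2) * poch b p.1 * poch c p.1 * poch d p.2 /
    (poch e (p.1 + p.2) * poch f (p.1 + p.2) * poch g p.2 *
      (Nat.factorial p.1 : ℂ) * (Nat.factorial p.2 : ℂ))

variable (a b c d : ℂ) {e f g : ℂ}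

theorem F1Coeff_succ (he : ∀ n : ℕ, e ≠ -(n : ℂ)) (hf : ∀ n : ℕ, f ≠ -(n : ℂ))
    (hg : ∀ n : ℕ, g ≠ -(n : ℂ)) (m n : ℕ) :
    (e + (m + n)) * (f + (m + n)) * (g + n) * (n + 1) * F1Coeff a b c d e f g (m, n + 1) =
      (a + (m + n)) * (d + n) * F1Coeff a b c d e f g (m, n) := by
  have he1 := poch_ne_zero he (m + n)
  have hf1 := poch_ne_zero hf (m + n)
  have hg1 := poch_ne_zero hg n
  have he2 : e + (m + n) ≠ 0 := fun h => he (m + n) (by push_cast; linear_combination h)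
  have hf2 : f + (m + n) ≠ 0 := fun h => hf (m + n) (by push_cast; linear_combination h)
  have hg2 : g + n ≠ 0 := fun h => hg n (by linear_combination h)
  have hn : (n : ℂ) + 1 ≠ 0 := Nat.cast_add_one_ne_zero n
  have hm_fact : (m.factorial : ℂ) ≠ 0 := Nat.cast_ne_zero.2 m.factorial_ne_zero
  have hn_fact : (n.factorial : ℂ) ≠ 0 := Nat.cast_ne_zero.2 n.factorial_ne_zero
  simp only [F1Coeff, ← add_assoc m n 1, poch_succ, Nat.factorial_succ, Nat.cast_mul,
    Nat.cast_add, Nat.cast_one]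
  field_simp

theorem stripSummable_F1Coeff (he : ∀ n : ℕ, e ≠ -(n : ℂ)) (hf : ∀ n : ℕ, f ≠ -(n : ℂ))
    (hg : ∀ n : ℕ, g ≠ -(n : ℂ)) : StripSummable (F1Coeff a b c d e f g) := by
  intro r R hr hr1 hR
  obtain ⟨q, hqr, hq⟩ : ∃ q : ℝ, q ^ 5 * r < 1 ∧ 1 < q := by
    have hcont : Tendsto (fun q : ℝ => q ^ 5 * r) (𝓝[>] 1) (𝓝 (1 ^ 5 * r)) :=
      (Continuous.tendsto (by fun_prop) 1).mono_left nhdsWithin_le_nhds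
    exact ((hcont.eventually_lt_const (by simpa using hr1)).and self_mem_nhdsWithin).exists
  have hq0 : 0 < q := by linarith
  obtain ⟨Ca, hCa, ha⟩ := exists_norm_poch_le a hq
  obtain ⟨Cb, hCb, hb⟩ := exists_norm_poch_le b hq
  obtain ⟨Cc, hCc, hc⟩ := exists_norm_poch_le c hq
  obtain ⟨Cd, hCd, hd⟩ := exists_norm_poch_le d hq
  obtain ⟨Ce, hCe, he⟩ := exists_norm_inv_poch_le he hq
  obtain ⟨Cf, hCf, hf⟩ := exists_norm_inv_poch_le hf hq
  obtain ⟨Cg, hCg, hg⟩ := exists_norm_inv_poch_le hg hq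
  have hgeom : Summable fun p : ℕ × ℕ =>
      (q ^ 5 * r) ^ p.1 * ((q ^ 5 * R) ^ p.2 / p.2.factorial) :=
    (summable_geometric_of_lt_one (by positivity) hqr).mul_of_nonneg
      (Real.summable_pow_div_factorial (q ^ 5 * R)) (fun _ => by positivity)
      (fun _ => by positivity)
  refine (hgeom.mul_left (Ca * Cb * Cc * Cd * Ce * Cf * Cg)).of_nonneg_of_le
    (fun p => by positivity) ?_
  rintro ⟨m, n⟩
  have hfact : (m.factorial : ℝ) / (m + n).factorial ≤ 1 :=
    div_le_one_of_le₀ (by exact_mod_cast Nat.factorial_le (Nat.le_add_right m n)) (by positivity)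
  have hnorm : ‖F1Coeff a b c d e f g (m, n)‖ = ‖poch a (m + n)‖ * ‖poch b m‖ * ‖poch c m‖ *
      ‖poch d n‖ * ‖(poch e (m + n))⁻¹‖ * ‖(poch f (m + n))⁻¹‖ * ‖(poch g n)⁻¹‖ /
      (m.factorial * n.factorial) := by
    simp only [F1Coeff, norm_div, norm_mul, norm_inv, Complex.norm_natCast]
    simp only [div_eq_mul_inv, mul_inv]
    ring
  have hbound : ‖F1Coeff a b c d e f g (m, n)‖ ≤
      Ca * Cb * Cc * Cd * Ce * Cf * Cg * ((q ^ 5) ^ m * (q ^ 5) ^ n / n.factorial) := by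
    rw [hnorm]
    calc _ ≤ (Ca * (q ^ (m + n) * (m + n).factorial)) * (Cb * (q ^ m * m.factorial)) *
          (Cc * (q ^ m * m.factorial)) * (Cd * (q ^ n * n.factorial)) *
          (Ce * (q ^ (m + n) / (m + n).factorial)) * (Cf * (q ^ (m + n) / (m + n).factorial)) *
          (Cg * (q ^ n / n.factorial)) / (m.factorial * n.factorial) := by
          gcongr
          exacts [ha _, hb _, hc _, hd _, he _, hf _, hg _]
      _ = Ca * Cb * Cc * Cd * Ce * Cf * Cg * ((q ^ 5) ^ m * (q ^ 5) ^ n / n.factorial) *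
          (m.factorial / (m + n).factorial) := by
          field_simp
          ring
      _ ≤ _ := mul_le_of_le_one_right (by positivity) hfact
  calc _ ≤ Ca * Cb * Cc * Cd * Ce * Cf * Cg * ((q ^ 5) ^ m * (q ^ 5) ^ n / n.factorial) *
        r ^ m * R ^ n := by gcongr
    _ = _ := by rw [mul_pow, mul_pow]; ring

end KampeDeFeriet

theorem stmt3 (a b c d e f g : ℂ)
    (he : ∀ n : ℕ, e ≠ -(n : ℂ)) (hf : ∀ n : ℕ, f ≠ -(n : ℂ)) (hg : ∀ n : ℕ, g ≠ -(n : ℂ))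
    (he' : ∀ n : ℕ, (1 - g + e) ≠ -(n : ℂ)) (hf' : ∀ n : ℕ, (1 - g + f) ≠ -(n : ℂ)) (hg' : ∀ n : ℕ, (2 - g) ≠ -(n : ℂ))
    (u : ℝ → ℝ → ℂ)
    (hu : u = fun x y : ℝ => Complex.exp ((1 - g) * (Real.log y : ℂ)) * F1 (1 - g + a) b c (1 - g + d) (1 - g + e) (1 - g + f) (2 - g) (x : ℂ) (y : ℂ)) :
    ∀ x y : ℝ, 0 < x → x < 1 → 0 < y →
      (y : ℂ) ^ 3 * pdy (pdy (pdy (pdy u))) x y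
        + (x : ℂ) ^ 2 * (y : ℂ) * pdy (pdy (pdx (pdx u))) x y
        + 2 * (x : ℂ) * (y : ℂ) ^ 2 * pdy (pdy (pdy (pdx u))) x y
        + (e + f + g + 3) * (y : ℂ) ^ 2 * pdy (pdy (pdy u)) x y
        + (e + f + 2 * g + 3) * (x : ℂ) * (y : ℂ) * pdy (pdy (pdx u)) x y
        + g * (x : ℂ) ^ 2 * pdy (pdx (pdx u)) x y
        + (((e + 1) * (f + 1) + (e + f + 1) * g) - (y : ℂ)) * (y : ℂ) * pdy (pdy u) x y
        + ((e + f + 1) * g - (y : ℂ)) * (x : ℂ) * pdy (pdx u) x y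
        - d * (x : ℂ) * pdx u x y
        + (e * f * g - (a + d + 1) * (y : ℂ)) * pdy u x y - a * d * u x y = 0 := by
  intro x y hx hx1 hy
  set A := F1Coeff (1 - g + a) b c (1 - g + d) (1 - g + e) (1 - g + f) (2 - g) with hAdef
  have hx0 : (x : ℂ) ≠ 0 := by exact_mod_cast hx.ne'
  have hy0 : (y : ℂ) ≠ 0 := by exact_mod_cast hy.ne'
  have hxn : ‖(x : ℂ)‖ < 1 := by rwa [Complex.norm_real, Real.norm_of_nonneg hx.le]
  have h0 : IsTwistedSeries (1 - g) u 0 0 A :=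
    ⟨stripSummable_F1Coeff _ _ _ _ he' hf' hg', fun x y _ _ _ => by simp [hu, F1, doubleSeries,
      hAdef, F1Coeff]⟩
  have hsum {v : ℝ → ℝ → ℂ} {i j : ℕ} {B : ℕ × ℕ → ℂ} (h : IsTwistedSeries (1 - g) v i j B) :=
    h.summable.hasSum (y := (y : ℂ)) hxn
  -- The part of the equation that preserves the degree in `y`, after multiplication by `y`.
  have hP := ((((((((hsum h0.pdy.pdy.pdy.pdy).add (hsum h0.pdx.pdx.pdy.pdy)).add
    ((hsum h0.pdx.pdy.pdy.pdy).mul_left 2)).add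
    ((hsum h0.pdy.pdy.pdy).mul_left (e + f + g + 3))).add
    ((hsum h0.pdx.pdy.pdy).mul_left (e + f + 2 * g + 3))).add
    ((hsum h0.pdx.pdx.pdy).mul_left g)).add
    ((hsum h0.pdy.pdy).mul_left ((e + 1) * (f + 1) + (e + f + 1) * g))).add
    ((hsum h0.pdx.pdy).mul_left ((e + f + 1) * g))).add ((hsum h0.pdy).mul_left (e * f * g))
  -- The part that raises the degree in `y` by one.
  have hQ := ((((hsum h0.pdy.pdy).add (hsum h0.pdx.pdy)).add ((hsum h0.pdx).mul_left d)).add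
    ((hsum h0.pdy).mul_left (a + d + 1))).add ((hsum h0).mul_left (a * d)) |>.mul_left (y : ℂ)
  have hinj : Function.Injective fun p : ℕ × ℕ => (p.1, p.2 + 1) := by
    rintro ⟨m, n⟩ ⟨m', n'⟩ h
    simpa using h
  have hPQ := (hinj.hasSum_iff (by
    rintro ⟨m, _ | n⟩ hp
    · push_cast
      ring
    · exact absurd ⟨(m, n), rfl⟩ hp)).2 hP
  have heq := hPQ.unique (hQ.congr_fun ?_)
  · rw [h0.eq x y hx hx1 hy, h0.pdy.eq x y hx hx1 hy, h0.pdx.eq x y hx hx1 hy,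
      h0.pdx.pdy.eq x y hx hx1 hy, h0.pdy.pdy.eq x y hx hx1 hy,
      h0.pdx.pdx.pdy.eq x y hx hx1 hy, h0.pdx.pdy.pdy.eq x y hx hx1 hy,
      h0.pdy.pdy.pdy.eq x y hx hx1 hy, h0.pdx.pdy.pdy.pdy.eq x y hx hx1 hy,
      h0.pdx.pdx.pdy.pdy.eq x y hx hx1 hy, h0.pdy.pdy.pdy.pdy.eq x y hx hx1 hy]
    refine Eq.trans ?_ (mul_eq_zero_of_right
      (Complex.exp ((1 - g) * (Real.log y : ℂ)) / y) (sub_eq_zero.2 heq))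
    field_simp
    ring
  · rintro ⟨m, n⟩
    have hrec := F1Coeff_succ (1 - g + a) b c (1 - g + d) he' hf' hg' m n
    rw [← hAdef] at hrec
    simp only [Function.comp_apply, pow_succ]
    push_cast
    linear_combination (x : ℂ) ^ m * (y : ℂ) ^ n * y * hrec
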